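/- Let N ≥ 1 and let u be a nonnegative harmonic function on the open ball B_R(x₀) ⊆ ℝ^N. Then for every r with 0 ≤ r < R and every x with ‖x − x₀‖ ≤ r one has (R/(R + r))^{N−2}·((R − r)/(R + r))·u(x₀) ≤ u(x) ≤ (R/(R − r))^{N−2}·((R + r)/(R − r))·u(x₀). -/

import Mathlib

open Metric

/-- The Laplacian of `u : ℝ^N → ℝ` at `x`, computed as the sum of second partial
derivatives in the coordinate directions. -/
noncomputable def laplacian {N : ℕ} (u : EuclideanSpace ℝ (Fin N) → ℝ)
    (x : EuclideanSpace ℝ (Fin N)) : ℝ :=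
  ∑ i, fderiv ℝ (fun y => fderiv ℝ u y (EuclideanSpace.single i 1)) x (EuclideanSpace.single i 1)

/-- `u` is harmonic on the open set `U`: it is twice continuously differentiable on `U`
and its Laplacian vanishes at every point of `U`. -/
def HarmonicOn {N : ℕ} (u : EuclideanSpace ℝ (Fin N) → ℝ)
    (U : Set (EuclideanSpace ℝ (Fin N))) : Prop :=
  ContDiffOn ℝ 2 u U ∧ ∀ x ∈ U, laplacian u x = 0

open Filter Topology MeasureTheory Set

def HSD {N : ℕ} (w : EuclideanSpace ℝ (Fin N) → ℝ) (x : EuclideanSpace ℝ (Fin N)) (L : ℝ) : Prop :=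
  ∃ (D : Fin N → ℝ → ℝ) (D2 : Fin N → ℝ),
    (∀ i, (∀ᶠ t in 𝓝 (0:ℝ), HasDerivAt (fun t : ℝ => w (x + t • EuclideanSpace.single i (1:ℝ))) (D i t) t) ∧
      HasDerivAt (D i) (D2 i) 0) ∧ ∑ i, D2 i = L

theorem HSD.add {N : ℕ} {w v : EuclideanSpace ℝ (Fin N) → ℝ} {x} {L M : ℝ} (h : HSD w x L) (k : HSD v x M) :
    HSD (fun y => w y + v y) x (L + M) := by
  obtain ⟨D, D2, h, rfl⟩ := h
  obtain ⟨E, E2, k, rfl⟩ := k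
  refine ⟨fun i t => D i t + E i t, fun i => D2 i + E2 i, fun i => ⟨?_, (h i).2.add (k i).2⟩,
    Finset.sum_add_distrib⟩
  filter_upwards [(h i).1, (k i).1] with t a b using a.add b

theorem HSD.smul {N : ℕ} {w : EuclideanSpace ℝ (Fin N) → ℝ} {x} {L : ℝ} (c : ℝ) (h : HSD w x L) :
    HSD (fun y => c * w y) x (c * L) := by
  obtain ⟨D, D2, h, rfl⟩ := h
  refine ⟨fun i t => c * D i t, fun i => c * D2 i, fun i => ⟨?_, (h i).2.const_mul c⟩,
    (Finset.mul_sum _ _ _).symm⟩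
  filter_upwards [(h i).1] with t a using a.const_mul c

theorem HSD.localMax {N : ℕ} {w : EuclideanSpace ℝ (Fin N) → ℝ} {x} {L : ℝ} (h : HSD w x L)
    (hm : IsLocalMax w x) : L ≤ 0 := by
  obtain ⟨D, D2, h, rfl⟩ := h
  refine Finset.sum_nonpos fun i _ => ?_
  by_contra! hp
  obtain ⟨h1, h2⟩ := h i
  set g : ℝ → ℝ := fun t : ℝ => w (x + t • EuclideanSpace.single i (1:ℝ)) with hg
  have hd : deriv g =ᶠ[𝓝 0] D i := by
    filter_upwards [h1] with t a using a.deriv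
  have hdd : deriv (deriv g) 0 = D2 i := by rw [hd.deriv_eq]; exact h2.deriv
  have hc : Tendsto (fun t : ℝ => x + t • EuclideanSpace.single i (1:ℝ)) (𝓝 0) (𝓝 x) := by
    have : Continuous (fun t : ℝ => x + t • EuclideanSpace.single i (1:ℝ)) := by fun_prop
    simpa using this.tendsto 0
  have hM : IsLocalMax g 0 := by
    have := hc.eventually hm
    filter_upwards [this] with t ht
    simpa [hg] using ht
  have hmin : IsLocalMin g 0 :=
    isLocalMin_of_deriv_deriv_pos (by rw [hdd]; exact hp) hM.deriv_eq_zero h1.self_of_nhds.continuousAt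
  have he : g =ᶠ[𝓝 0] fun _ => g 0 := by
    filter_upwards [hM, hmin] with t a b using le_antisymm a b
  have := he.deriv.deriv_eq
  rw [hdd] at this
  simp at this
  linarith

theorem HSD.normSq {N : ℕ} (x : EuclideanSpace ℝ (Fin N)) : HSD (fun y => ‖y‖ ^ 2) x (2 * N) := by
  refine ⟨fun i t => 2 * x i + 2 * t, fun i => 2, fun i => ⟨Eventually.of_forall fun t => ?_, ?_⟩, ?_⟩
  · have : (fun t : ℝ => ‖x + t • EuclideanSpace.single i (1:ℝ)‖ ^ 2) =
        fun t => ‖x‖ ^ 2 + 2 * t * x i + t ^ 2 := by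
      ext t
      rw [norm_add_sq_real, inner_smul_right, norm_smul]
      simp [EuclideanSpace.inner_single_right]
      ring
    rw [this]
    have := (((hasDerivAt_id t).const_mul 2).mul_const (x i)).const_add (‖x‖^2) |>.add
      ((hasDerivAt_id t).pow 2)
    refine this.congr_deriv ?_
    simp
  · simpa using ((hasDerivAt_id (0:ℝ)).const_mul 2).const_add (2 * x i)
  · simp [mul_comm]

theorem maxPrinciple {N : ℕ} (hN : 1 ≤ N) {s M : ℝ} {w : EuclideanSpace ℝ (Fin N) → ℝ}
    (hc : ContinuousOn w (closedBall 0 s)) (hw : ∀ x ∈ ball 0 s, HSD w x 0)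
    (hM : ∀ x, ‖x‖ = s → w x ≤ M) : ∀ x ∈ closedBall 0 s, w x ≤ M := by
  intro x hx
  have hs : 0 ≤ s := (norm_nonneg x).trans (by simpa using hx)
  refine le_of_forall_pos_le_add fun ε hε => ?_
  set η := ε / (s ^ 2 + 1) with hη
  have hη0 : 0 < η := by positivity
  have hηs : η * s ^ 2 ≤ ε := by
    rw [hη, div_mul_eq_mul_div, div_le_iff₀ (by positivity)]; nlinarith
  obtain ⟨z, hz, hmax⟩ := (isCompact_closedBall (0 : EuclideanSpace ℝ (Fin N)) s).exists_isMaxOn ⟨x, hx⟩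
    (f := fun y => w y + η * ‖y‖ ^ 2) (by fun_prop)
  have h1 : w x + η * ‖x‖^2 ≤ w z + η * ‖z‖ ^ 2 := hmax hx
  have hx0 : 0 ≤ η * ‖x‖^2 := by positivity
  have hz' : ‖z‖ ≤ s := by simpa using hz
  rcases hz'.lt_or_eq with hlt | heq
  · exfalso
    have hzb : z ∈ ball 0 s := by simpa using hlt
    have hl : IsLocalMax (fun y => w y + η * ‖y‖ ^ 2) z :=
      hmax.isLocalMax (mem_of_superset (isOpen_ball.mem_nhds hzb) ball_subset_closedBall)
    have := ((hw z hzb).add ((HSD.normSq z).smul η)).localMax hl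
    have hN' : (1:ℝ) ≤ N := by exact_mod_cast hN
    have : 0 < η * (2 * N) := by positivity
    linarith
  · have := hM z heq
    rw [heq] at h1
    linarith

theorem int_deriv {N : ℕ} {σ : Measure (EuclideanSpace ℝ (Fin N))} [IsFiniteMeasure σ]
    {S : Set (EuclideanSpace ℝ (Fin N))} (hS : IsCompact S) (hσ : ∀ᵐ z ∂σ, z ∈ S)
    {f : EuclideanSpace ℝ (Fin N) → ℝ} (hf : ContinuousOn f S)
    {G G' : ℝ → EuclideanSpace ℝ (Fin N) → ℝ} {δ : ℝ}
    (hG : ContinuousOn (fun p : ℝ × EuclideanSpace ℝ (Fin N) => G p.1 p.2) (Icc (-δ) δ ×ˢ S))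
    (hG' : ContinuousOn (fun p : ℝ × EuclideanSpace ℝ (Fin N) => G' p.1 p.2) (Icc (-δ) δ ×ˢ S))
    (hd : ∀ t ∈ Ioo (-δ) δ, ∀ z ∈ S, HasDerivAt (fun t => G t z) (G' t z) t) :
    ∀ t ∈ Ioo (-δ) δ, HasDerivAt (fun t => ∫ z, G t z * f z ∂σ) (∫ z, G' t z * f z ∂σ) t := by
  intro t ht
  have hr : σ.restrict S = σ := Measure.restrict_eq_self_of_ae_mem hσ
  have hslice : ∀ {H : ℝ → EuclideanSpace ℝ (Fin N) → ℝ},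
      ContinuousOn (fun p : ℝ × EuclideanSpace ℝ (Fin N) => H p.1 p.2) (Icc (-δ) δ ×ˢ S) →
      ∀ t ∈ Ioo (-δ) δ, ContinuousOn (fun z => H t z * f z) S := by
    intro H hH t ht
    refine ContinuousOn.mul ?_ hf
    exact hH.comp (f := fun z => (t, z)) (by fun_prop) fun z hz => ⟨Ioo_subset_Icc_self ht, hz⟩
  obtain ⟨C, hC⟩ := (isCompact_Icc.prod hS).exists_bound_of_continuousOn hG'
  obtain ⟨M, hM⟩ := hS.exists_bound_of_continuousOn hf
  refine (hasDerivAt_integral_of_dominated_loc_of_deriv_le (μ := σ) (F := fun t z => G t z * f z)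
    (F' := fun t z => G' t z * f z) (bound := fun _ => C * M)
    (isOpen_Ioo.mem_nhds ht) ?_ ?_ ?_ ?_ ?_ ?_).2
  · filter_upwards [isOpen_Ioo.mem_nhds ht] with s hs
    rw [← hr]
    exact (hslice hG s hs).aestronglyMeasurable hS.measurableSet
  · rw [← hr]
    exact (hslice hG t ht).integrableOn_compact hS
  · rw [← hr]
    exact (hslice hG' t ht).aestronglyMeasurable hS.measurableSet
  · filter_upwards [hσ] with z hz s hs
    rw [norm_mul]
    have h1 := hC (s, z) ⟨Ioo_subset_Icc_self hs, hz⟩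
    exact mul_le_mul h1 (hM z hz) (norm_nonneg _) ((norm_nonneg _).trans h1)
  · exact integrable_const _
  · filter_upwards [hσ] with z hz s hs
    exact (hd s hs z hz).mul_const _

theorem exists_sigma {N : ℕ} (hN : 1 ≤ N) {ρ : ℝ} (hρ : 0 < ρ) :
    ∃ σ : Measure (EuclideanSpace ℝ (Fin N)), IsFiniteMeasure σ ∧
      (∀ᵐ z ∂σ, z ∈ sphere (0 : EuclideanSpace ℝ (Fin N)) ρ) ∧ σ ≠ 0 ∧
      ∀ L : EuclideanSpace ℝ (Fin N) ≃ₗᵢ[ℝ] EuclideanSpace ℝ (Fin N), Measure.map L σ = σ := by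
  set A : Set (EuclideanSpace ℝ (Fin N)) := ball 0 2 \ closedBall 0 1 with hA
  have hAo : IsOpen A := isOpen_ball.sdiff isClosed_closedBall
  have hAv : volume A < ⊤ := (measure_mono sdiff_subset).trans_lt measure_ball_lt_top
  set φ : EuclideanSpace ℝ (Fin N) → EuclideanSpace ℝ (Fin N) := fun g => (ρ / ‖g‖) • g with hφ
  have hφm : Measurable φ := by fun_prop
  have : IsFiniteMeasure (volume.restrict A) := ⟨by simpa using hAv⟩
  refine ⟨Measure.map φ (volume.restrict A), inferInstance, ?_, ?_, ?_⟩
  · refine (ae_map_iff (p := fun z => z ∈ sphere (0 : EuclideanSpace ℝ (Fin N)) ρ) hφm.aemeasurable isClosed_sphere.measurableSet).2 ?_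
    filter_upwards [ae_restrict_mem hAo.measurableSet] with g hg
    have h1 : 1 < ‖g‖ := by simpa using hg.2
    have : ‖g‖ ≠ 0 := by linarith
    simp only [hφ, mem_sphere_zero_iff_norm, norm_smul, norm_div, Real.norm_eq_abs, abs_norm,
      abs_of_pos hρ]
    field_simp
  · rw [Ne, Measure.map_eq_zero_iff hφm.aemeasurable, Measure.restrict_eq_zero]
    refine (hAo.measure_pos _ ⟨EuclideanSpace.single ⟨0, hN⟩ (3/2 : ℝ), ?_⟩).ne'
    simp [hA]
    norm_num [abs_of_pos]
  · intro L
    have hLA : L ⁻¹' A = A := by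
      ext g; simp [hA]
    have hL := L.measurePreserving.restrict_preimage hAo.measurableSet
    rw [hLA] at hL
    have hLm : Measurable L := L.continuous.measurable
    rw [Measure.map_map hLm hφm]
    have : L ∘ φ = φ ∘ L := by
      ext1 g; simp [hφ]
    rw [this, ← Measure.map_map hφm hLm, hL.map_eq]

noncomputable def qK0 (a0 a1 q0 q1 p t : ℝ) : ℝ :=
  (a0 - 2 * t * a1 - t ^ 2) * (q0 + 2 * t * q1 + t ^ 2) ^ p
noncomputable def qK1 (a0 a1 q0 q1 p t : ℝ) : ℝ :=
  (-2 * a1 - 2 * t) * (q0 + 2 * t * q1 + t ^ 2) ^ p +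
    (a0 - 2 * t * a1 - t ^ 2) * ((2 * q1 + 2 * t) * p * (q0 + 2 * t * q1 + t ^ 2) ^ (p - 1))
noncomputable def qK2 (a0 a1 q0 q1 p t : ℝ) : ℝ :=
  (-2) * (q0 + 2 * t * q1 + t ^ 2) ^ p +
    2 * (-2 * a1 - 2 * t) * ((2 * q1 + 2 * t) * p * (q0 + 2 * t * q1 + t ^ 2) ^ (p - 1)) +
    (a0 - 2 * t * a1 - t ^ 2) * (2 * p * (q0 + 2 * t * q1 + t ^ 2) ^ (p - 1) +
      (2 * q1 + 2 * t) ^ 2 * p * (p - 1) * (q0 + 2 * t * q1 + t ^ 2) ^ (p - 1 - 1))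

theorem qder (q0 q1 t : ℝ) : HasDerivAt (fun t : ℝ => q0 + 2 * t * q1 + t ^ 2) (2 * q1 + 2 * t) t := by
  have := (((hasDerivAt_id t).const_mul 2).mul_const q1).const_add q0 |>.add
      ((hasDerivAt_id t).pow 2)
  refine this.congr_deriv ?_
  simp

theorem ader (q0 q1 t : ℝ) : HasDerivAt (fun t : ℝ => q0 - 2 * t * q1 - t ^ 2) (-2 * q1 - 2 * t) t := by
  have := (((hasDerivAt_id t).const_mul 2).mul_const q1).const_sub q0 |>.sub
      ((hasDerivAt_id t).pow 2)
  refine this.congr_deriv ?_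
  simp

theorem qK0_der (a0 a1 q0 q1 p t : ℝ) (h : q0 + 2 * t * q1 + t ^ 2 ≠ 0) :
    HasDerivAt (qK0 a0 a1 q0 q1 p) (qK1 a0 a1 q0 q1 p t) t := by
  unfold qK0 qK1
  exact (ader a0 a1 t).mul ((qder q0 q1 t).rpow_const (Or.inl h))

theorem qK1_der (a0 a1 q0 q1 p t : ℝ) (h : q0 + 2 * t * q1 + t ^ 2 ≠ 0) :
    HasDerivAt (qK1 a0 a1 q0 q1 p) (qK2 a0 a1 q0 q1 p t) t := by
  unfold qK1 qK2
  have l1 : HasDerivAt (fun t : ℝ => -2 * a1 - 2 * t) (-2) t := by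
    simpa using ((hasDerivAt_id t).const_mul 2).const_sub (-2 * a1)
  have l2 : HasDerivAt (fun t : ℝ => 2 * q1 + 2 * t) 2 t := by
    simpa using ((hasDerivAt_id t).const_mul 2).const_add (2 * q1)
  refine ((l1.mul ((qder q0 q1 t).rpow_const (Or.inl h))).add
    ((ader a0 a1 t).mul ((l2.mul_const p).mul ((qder q0 q1 t).rpow_const (Or.inl h))))).congr_deriv ?_
  simp only [Pi.mul_apply]
  ring

noncomputable def PK {N : ℕ} (ρ : ℝ) (x z : EuclideanSpace ℝ (Fin N)) : ℝ :=
  (ρ ^ 2 - ‖x‖ ^ 2) * (‖x - z‖ ^ 2) ^ (-(N : ℝ) / 2)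

theorem nsq {N : ℕ} (x : EuclideanSpace ℝ (Fin N)) (i : Fin N) (t : ℝ) :
    ‖x + t • EuclideanSpace.single i (1:ℝ)‖ ^ 2 = ‖x‖ ^ 2 + 2 * t * x i + t ^ 2 := by
  rw [norm_add_sq_real, inner_smul_right, norm_smul]
  simp [EuclideanSpace.inner_single_right]
  ring

theorem PK_line {N : ℕ} (ρ : ℝ) (x z : EuclideanSpace ℝ (Fin N)) (i : Fin N) (t : ℝ) :
    PK ρ (x + t • EuclideanSpace.single i (1:ℝ)) z =
      qK0 (ρ ^ 2 - ‖x‖ ^ 2) (x i) (‖x - z‖ ^ 2) ((x - z) i) (-(N : ℝ) / 2) t := by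
  unfold PK qK0
  rw [add_sub_right_comm, nsq, nsq]
  ring

theorem PK_sum {N : ℕ} {ρ : ℝ} (x z : EuclideanSpace ℝ (Fin N)) (hx : ‖x‖ < ρ) (hz : ‖z‖ = ρ) :
    ∑ i, qK2 (ρ ^ 2 - ‖x‖ ^ 2) (x i) (‖x - z‖ ^ 2) ((x - z) i) (-(N : ℝ) / 2) 0 = 0 := by
  have hne : 0 < ‖x - z‖ ^ 2 := by
    have : x - z ≠ 0 := by
      rintro h; rw [sub_eq_zero] at h; rw [h] at hx; linarith
    positivity
  set q := ‖x - z‖ ^ 2 with hq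
  set p : ℝ := -(N : ℝ) / 2 with hp
  have e1 : q ^ p = q ^ (p - 1 - 1) * q ^ 2 := by
    rw [← Real.rpow_natCast, ← Real.rpow_add hne]; congr 1; push_cast; ring
  have e2 : q ^ (p - 1) = q ^ (p - 1 - 1) * q := by
    nth_rw 3 [← Real.rpow_one q]
    rw [← Real.rpow_add hne]; congr 1; ring
  have s1 : ∑ i, x i * (x - z) i = inner ℝ x (x - z) := by
    simp [PiLp.inner_apply, mul_comm]
  have s2 : ∑ i, (x - z) i ^ 2 = q := by
    rw [hq, EuclideanSpace.real_norm_sq_eq]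
  have e : ∀ i, qK2 (ρ ^ 2 - ‖x‖ ^ 2) (x i) q ((x - z) i) p 0 =
      q ^ (p - 1 - 1) * q * (-2 * q + (ρ ^ 2 - ‖x‖ ^ 2) * 2 * p) +
      q ^ (p - 1 - 1) * q * (-8 * p) * (x i * (x - z) i) +
      q ^ (p - 1 - 1) * (ρ ^ 2 - ‖x‖ ^ 2) * 4 * p * (p - 1) * ((x - z) i ^ 2) := by
    intro i
    simp only [qK2, mul_zero, zero_mul, add_zero, sub_zero, zero_pow two_ne_zero]
    rw [e1, e2]; ring
  rw [Finset.sum_congr rfl fun i _ => e i]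
  rw [Finset.sum_add_distrib, Finset.sum_add_distrib, ← Finset.mul_sum _ _ (q ^ (p - 1 - 1) * q * (-8 * p)),
    ← Finset.mul_sum _ _ (q ^ (p - 1 - 1) * (ρ ^ 2 - ‖x‖ ^ 2) * 4 * p * (p - 1)), s1, s2]
  simp only [Finset.sum_const, Finset.card_univ, Fintype.card_fin, nsmul_eq_mul]
  have h1 : q = ‖x‖ ^ 2 - 2 * inner ℝ x z + ρ ^ 2 := by rw [hq, norm_sub_sq_real, hz]
  have h2 : inner ℝ x (x - z) = ‖x‖ ^ 2 - inner ℝ x z := by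
    rw [inner_sub_right, real_inner_self_eq_norm_sq]
  have h3 : inner ℝ x z = (‖x‖ ^ 2 + ρ ^ 2 - q) / 2 := by linarith
  rw [h2, h3]
  have hN : (N : ℝ) = -2 * p := by rw [hp]; ring
  rw [hN]
  ring

theorem sphere_ne {N : ℕ} {ρ : ℝ} {x z : EuclideanSpace ℝ (Fin N)} (hx : ‖x‖ < ρ) (hz : ‖z‖ = ρ) :
    0 < ‖x - z‖ := by
  rw [norm_pos_iff]
  rintro h; rw [sub_eq_zero] at h; rw [h] at hx; linarith

theorem PK_cont {N : ℕ} (ρ : ℝ) :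
    ContinuousOn (fun p : EuclideanSpace ℝ (Fin N) × EuclideanSpace ℝ (Fin N) => PK ρ p.1 p.2)
      (ball 0 ρ ×ˢ sphere 0 ρ) := by
  unfold PK
  refine ContinuousOn.mul (by fun_prop) (ContinuousOn.rpow_const (by fun_prop) ?_)
  rintro ⟨x, z⟩ ⟨hx, hz⟩
  left
  have := sphere_ne (mem_ball_zero_iff.1 hx) (mem_sphere_zero_iff_norm.1 hz)
  positivity

theorem PK_slice {N : ℕ} {ρ : ℝ} {x : EuclideanSpace ℝ (Fin N)} (hx : ‖x‖ < ρ) :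
    ContinuousOn (fun z => PK ρ x z) (sphere 0 ρ) :=
  (PK_cont ρ).comp (f := fun z => (x, z)) (by fun_prop)
    fun z hz => ⟨by simpa using hx, hz⟩

theorem sint {N : ℕ} {σ : Measure (EuclideanSpace ℝ (Fin N))} [IsFiniteMeasure σ]
    {ρ : ℝ} (hσ : ∀ᵐ z ∂σ, z ∈ sphere (0 : EuclideanSpace ℝ (Fin N)) ρ)
    {f : EuclideanSpace ℝ (Fin N) → ℝ} (hf : ContinuousOn f (sphere 0 ρ)) : Integrable f σ := by
  rw [← Measure.restrict_eq_self_of_ae_mem hσ]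
  exact hf.integrableOn_compact (isCompact_sphere _ _)

theorem PI_cont {N : ℕ} {σ : Measure (EuclideanSpace ℝ (Fin N))} [IsFiniteMeasure σ]
    {ρ s : ℝ} (hs : s < ρ) (hσ : ∀ᵐ z ∂σ, z ∈ sphere (0 : EuclideanSpace ℝ (Fin N)) ρ)
    {f : EuclideanSpace ℝ (Fin N) → ℝ} (hf : ContinuousOn f (sphere 0 ρ)) :
    ContinuousOn (fun x => ∫ z, PK ρ x z * f z ∂σ) (closedBall 0 s) := by
  have hsub : closedBall (0 : EuclideanSpace ℝ (Fin N)) s ⊆ ball 0 ρ := closedBall_subset_ball hs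
  have hc : ContinuousOn (fun p : EuclideanSpace ℝ (Fin N) × EuclideanSpace ℝ (Fin N) =>
      PK ρ p.1 p.2 * f p.2) (closedBall 0 s ×ˢ sphere 0 ρ) :=
    ((PK_cont ρ).mono (prod_mono_left hsub)).mul (hf.comp continuousOn_snd fun p hp => hp.2)
  obtain ⟨C, hC⟩ := ((isCompact_closedBall _ _).prod (isCompact_sphere _ _)).exists_bound_of_continuousOn hc
  refine continuousOn_of_dominated (bound := fun _ => C) ?_ ?_ (integrable_const _) ?_
  · intro x hx
    exact (sint hσ ((PK_slice (by simpa using hsub hx)).mul hf)).aestronglyMeasurable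
  · intro x hx
    filter_upwards [hσ] with z hz using hC (x, z) ⟨hx, hz⟩
  · filter_upwards [hσ] with z hz
    exact hc.comp (f := fun x => (x, z)) (by fun_prop) fun x hx => ⟨hx, hz⟩

theorem PI_HSD {N : ℕ} {σ : Measure (EuclideanSpace ℝ (Fin N))} [IsFiniteMeasure σ]
    {ρ : ℝ} (hσ : ∀ᵐ z ∂σ, z ∈ sphere (0 : EuclideanSpace ℝ (Fin N)) ρ)
    {f : EuclideanSpace ℝ (Fin N) → ℝ} (hf : ContinuousOn f (sphere 0 ρ))
    {x : EuclideanSpace ℝ (Fin N)} (hx : ‖x‖ < ρ) :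
    HSD (fun x => ∫ z, PK ρ x z * f z ∂σ) x 0 := by
  obtain ⟨δ, hδ⟩ : ∃ δ, δ = (ρ - ‖x‖) / 2 := ⟨_, rfl⟩
  have hδ0 : 0 < δ := by linarith
  have hpos : ∀ i, ∀ t ∈ Icc (-δ) δ, ∀ z ∈ sphere (0 : EuclideanSpace ℝ (Fin N)) ρ,
      ‖x - z‖ ^ 2 + 2 * t * (x - z) i + t ^ 2 ≠ 0 := by
    intro i t ht z hz
    rw [← nsq, ← add_sub_right_comm]
    have h1 : ‖x + t • EuclideanSpace.single i (1:ℝ)‖ < ρ := by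
      refine (norm_add_le _ _).trans_lt ?_
      have : |t| ≤ δ := abs_le.2 ht
      simp [norm_smul]
      linarith
    have := sphere_ne h1 (mem_sphere_zero_iff_norm.1 hz)
    positivity
  have c0 : ∀ i, ContinuousOn (fun p : ℝ × EuclideanSpace ℝ (Fin N) =>
      qK0 (ρ ^ 2 - ‖x‖ ^ 2) (x i) (‖x - p.2‖ ^ 2) ((x - p.2) i) (-(N : ℝ) / 2) p.1)
      (Icc (-δ) δ ×ˢ sphere 0 ρ) := by
    intro i
    have hr : ∀ p : ℝ, ContinuousOn (fun y : ℝ × EuclideanSpace ℝ (Fin N) =>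
        (‖x - y.2‖ ^ 2 + 2 * y.1 * (x - y.2) i + y.1 ^ 2) ^ p) (Icc (-δ) δ ×ˢ sphere 0 ρ) := fun p =>
      ContinuousOn.rpow_const (by fun_prop) fun y hy => Or.inl (hpos i _ hy.1 _ hy.2)
    unfold qK0
    exact ContinuousOn.mul (by fun_prop) (hr _)
  have c1 : ∀ i, ContinuousOn (fun p : ℝ × EuclideanSpace ℝ (Fin N) =>
      qK1 (ρ ^ 2 - ‖x‖ ^ 2) (x i) (‖x - p.2‖ ^ 2) ((x - p.2) i) (-(N : ℝ) / 2) p.1)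
      (Icc (-δ) δ ×ˢ sphere 0 ρ) := by
    intro i
    have hr : ∀ p : ℝ, ContinuousOn (fun y : ℝ × EuclideanSpace ℝ (Fin N) =>
        (‖x - y.2‖ ^ 2 + 2 * y.1 * (x - y.2) i + y.1 ^ 2) ^ p) (Icc (-δ) δ ×ˢ sphere 0 ρ) := fun p =>
      ContinuousOn.rpow_const (by fun_prop) fun y hy => Or.inl (hpos i _ hy.1 _ hy.2)
    unfold qK1
    exact (ContinuousOn.mul (by fun_prop) (hr _)).add
      (ContinuousOn.mul (by fun_prop) (ContinuousOn.mul (by fun_prop) (hr _)))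
  have c2 : ∀ i, ContinuousOn (fun p : ℝ × EuclideanSpace ℝ (Fin N) =>
      qK2 (ρ ^ 2 - ‖x‖ ^ 2) (x i) (‖x - p.2‖ ^ 2) ((x - p.2) i) (-(N : ℝ) / 2) p.1)
      (Icc (-δ) δ ×ˢ sphere 0 ρ) := by
    intro i
    have hr : ∀ p : ℝ, ContinuousOn (fun y : ℝ × EuclideanSpace ℝ (Fin N) =>
        (‖x - y.2‖ ^ 2 + 2 * y.1 * (x - y.2) i + y.1 ^ 2) ^ p) (Icc (-δ) δ ×ˢ sphere 0 ρ) := fun p =>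
      ContinuousOn.rpow_const (by fun_prop) fun y hy => Or.inl (hpos i _ hy.1 _ hy.2)
    unfold qK2
    exact ((ContinuousOn.mul (by fun_prop) (hr _)).add
      (ContinuousOn.mul (by fun_prop) (ContinuousOn.mul (by fun_prop) (hr _)))).add
      (ContinuousOn.mul (by fun_prop) ((ContinuousOn.mul (by fun_prop) (hr _)).add
        (ContinuousOn.mul (by fun_prop) (hr _))))
  have h0 : (0:ℝ) ∈ Ioo (-δ) δ := ⟨by linarith, hδ0⟩
  refine ⟨fun i t => ∫ z, qK1 (ρ ^ 2 - ‖x‖ ^ 2) (x i) (‖x - z‖ ^ 2) ((x - z) i) (-(N : ℝ) / 2) t * f z ∂σ,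
    fun i => ∫ z, qK2 (ρ ^ 2 - ‖x‖ ^ 2) (x i) (‖x - z‖ ^ 2) ((x - z) i) (-(N : ℝ) / 2) 0 * f z ∂σ,
    fun i => ⟨?_, ?_⟩, ?_⟩
  · filter_upwards [isOpen_Ioo.mem_nhds h0] with t ht
    simp only [PK_line]
    exact int_deriv (isCompact_sphere 0 ρ) hσ hf (c0 i) (c1 i)
      (fun t ht z hz => qK0_der _ _ _ _ _ _ (hpos i t (Ioo_subset_Icc_self ht) z hz)) t ht
  · exact int_deriv (isCompact_sphere 0 ρ) hσ hf (c1 i) (c2 i)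
      (fun t ht z hz => qK1_der _ _ _ _ _ _ (hpos i t (Ioo_subset_Icc_self ht) z hz)) 0 h0
  · rw [← integral_finsetSum]
    · refine integral_eq_zero_of_ae ?_
      filter_upwards [hσ] with z hz
      rw [← Finset.sum_mul, PK_sum x z hx (mem_sphere_zero_iff_norm.1 hz), zero_mul, Pi.zero_apply]
    · intro i _
      refine sint hσ (ContinuousOn.mul ?_ hf)
      exact (c2 i).comp (f := fun z => ((0:ℝ), z)) (by fun_prop) fun z hz => ⟨Ioo_subset_Icc_self h0, hz⟩

theorem PK_nonneg {N : ℕ} {ρ : ℝ} {x : EuclideanSpace ℝ (Fin N)} (hx : ‖x‖ < ρ)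
    (z : EuclideanSpace ℝ (Fin N)) : 0 ≤ PK ρ x z := by
  unfold PK
  have := norm_nonneg x
  have : 0 ≤ ρ ^ 2 - ‖x‖ ^ 2 := by nlinarith
  positivity

theorem PK_eq {N : ℕ} (ρ : ℝ) (x z : EuclideanSpace ℝ (Fin N)) :
    PK ρ x z = (ρ ^ 2 - ‖x‖ ^ 2) / ‖x - z‖ ^ N := by
  have h : (‖x - z‖ ^ 2) ^ (-(N : ℝ) / 2) = (‖x - z‖ ^ N)⁻¹ := by
    rw [← Real.rpow_natCast _ 2, ← Real.rpow_natCast _ N, ← Real.rpow_mul (norm_nonneg (x - z)),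
      ← Real.rpow_neg (norm_nonneg _)]
    congr 1
    push_cast; ring
  unfold PK
  rw [h, div_eq_mul_inv]

theorem PI_one {N : ℕ} (hN : 1 ≤ N) {σ : Measure (EuclideanSpace ℝ (Fin N))} [IsFiniteMeasure σ]
    {ρ : ℝ} (hσ : ∀ᵐ z ∂σ, z ∈ sphere (0 : EuclideanSpace ℝ (Fin N)) ρ)
    (hL : ∀ L : EuclideanSpace ℝ (Fin N) ≃ₗᵢ[ℝ] EuclideanSpace ℝ (Fin N), Measure.map L σ = σ)
    {x : EuclideanSpace ℝ (Fin N)} (hx : ‖x‖ < ρ) :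
    ∫ z, PK ρ x z ∂σ = ∫ z, PK ρ 0 z ∂σ := by
  have hrad : ∀ y : EuclideanSpace ℝ (Fin N), ‖y‖ = ‖x‖ → ∫ z, PK ρ y z ∂σ = ∫ z, PK ρ x z ∂σ := by
    intro y hy
    set L := Submodule.reflection (ℝ ∙ (x - y))ᗮ
    have h1 : L x = y := Submodule.reflection_sub hy.symm
    conv_lhs => rw [← hL L]
    rw [← LinearIsometryEquiv.coe_toMeasurableEquiv, integral_map_equiv]
    refine integral_congr_ae (Eventually.of_forall fun z => ?_)
    simp only [LinearIsometryEquiv.coe_toMeasurableEquiv, PK]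
    rw [← h1, ← map_sub, L.norm_map, L.norm_map]
  have hc := PI_cont (s := ‖x‖) hx hσ (f := fun _ => 1) continuousOn_const
  have hh : ∀ y ∈ ball 0 ‖x‖, HSD (fun y => ∫ z, PK ρ y z * 1 ∂σ) y 0 := fun y hy =>
    PI_HSD hσ (f := fun _ => 1) continuousOn_const ((mem_ball_zero_iff.1 hy).trans hx)
  simp only [mul_one] at hc hh
  have h0 : (0 : EuclideanSpace ℝ (Fin N)) ∈ closedBall 0 ‖x‖ := by simp
  apply le_antisymm
  · have := maxPrinciple hN (w := fun y => -1 * ∫ z, PK ρ y z ∂σ) (M := -1 * ∫ z, PK ρ x z ∂σ) (s := ‖x‖)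
      (continuousOn_const.mul hc) (fun y hy => by simpa using (hh y hy).smul (-1))
      (fun y hy => by rw [hrad y hy]) 0 h0
    linarith
  · exact maxPrinciple hN (M := ∫ z, PK ρ x z ∂σ) hc hh (fun y hy => by rw [hrad y hy]) 0 h0

theorem poisson {N : ℕ} (hN : 1 ≤ N) {σ : Measure (EuclideanSpace ℝ (Fin N))} [IsFiniteMeasure σ]
    {ρ : ℝ} (hρ : 0 < ρ) (hσ : ∀ᵐ z ∂σ, z ∈ sphere (0 : EuclideanSpace ℝ (Fin N)) ρ)
    (hL : ∀ L : EuclideanSpace ℝ (Fin N) ≃ₗᵢ[ℝ] EuclideanSpace ℝ (Fin N), Measure.map L σ = σ)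
    {f : EuclideanSpace ℝ (Fin N) → ℝ} (hf : ContinuousOn f (closedBall 0 ρ))
    (hh : ∀ x ∈ ball 0 ρ, HSD f x 0)
    {x : EuclideanSpace ℝ (Fin N)} (hx : ‖x‖ < ρ) :
    ∫ z, PK ρ x z * f z ∂σ = (∫ z, PK ρ 0 z ∂σ) * f x := by
  set c := ∫ z, PK ρ 0 z ∂σ with hc
  have hc0 : 0 ≤ c := integral_nonneg fun z => PK_nonneg (by simpa using hρ) z
  have hfs : ContinuousOn f (sphere 0 ρ) := hf.mono sphere_subset_closedBall
  set W : EuclideanSpace ℝ (Fin N) → ℝ := fun y => (∫ z, PK ρ y z * f z ∂σ) + (-c) * f y with hW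
  have hWh : ∀ y, ‖y‖ < ρ → HSD W y 0 := fun y hy => by
    have h := (PI_HSD hσ hfs hy).add ((hh y (by simpa using hy)).smul (-c))
    rw [mul_zero, add_zero] at h
    exact h
  have hWc : ∀ s < ρ, ContinuousOn W (closedBall 0 s) := fun s hs =>
    (PI_cont hs hσ hfs).add (continuousOn_const.mul (hf.mono (closedBall_subset_closedBall hs.le)))
  have key : ∀ ε > 0, |W x| ≤ ε := by
    intro ε hε
    obtain ⟨M, hM⟩ := (isCompact_closedBall (0 : EuclideanSpace ℝ (Fin N)) ρ).exists_bound_of_continuousOn hf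
    have hM0 : 0 ≤ M := (norm_nonneg _).trans (hM 0 (by simp [hρ.le]))
    have huc := (isCompact_closedBall (0 : EuclideanSpace ℝ (Fin N)) ρ).uniformContinuousOn_of_continuous hf
    rw [Metric.uniformContinuousOn_iff] at huc
    obtain ⟨ε', hε'0, hε'⟩ : ∃ ε' > 0, c * ε' ≤ ε / 2 := by
      refine ⟨ε / 2 / (c + 1), by positivity, ?_⟩
      rw [mul_div_assoc', div_le_iff₀ (by positivity)]
      nlinarith
    obtain ⟨δ, hδ, hδf⟩ := huc ε' hε'0
    set m := σ.real univ with hm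
    have hm0 : 0 ≤ m := measureReal_nonneg
    -- estimate near the boundary
    have est : ∀ y, ‖y‖ < ρ → |W y| ≤ ε' * c + (ρ ^ 2 - ‖y‖ ^ 2) * (2 * M / δ ^ N * m) := by
      intro y hy
      have i1 : Integrable (fun z => PK ρ y z) σ := sint hσ (PK_slice hy)
      have i2 : Integrable (fun z => PK ρ y z * f z) σ := sint hσ ((PK_slice hy).mul hfs)
      have hpos : 0 ≤ ρ ^ 2 - ‖y‖ ^ 2 := by nlinarith [norm_nonneg y]
      have e1 : W y = ∫ z, (PK ρ y z * f z - PK ρ y z * f y) ∂σ := by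
        rw [integral_sub i2 (i1.mul_const _), integral_mul_const, PI_one hN hσ hL hy]
        simp only [hW]; ring
      rw [e1]
      have e2 : ε' * c + (ρ ^ 2 - ‖y‖ ^ 2) * (2 * M / δ ^ N * m) =
          ∫ z, (ε' * PK ρ y z + (ρ ^ 2 - ‖y‖ ^ 2) * (2 * M / δ ^ N)) ∂σ := by
        rw [integral_add (i1.const_mul _) (integrable_const _), integral_const_mul,
          PI_one hN hσ hL hy, integral_const, smul_eq_mul]
        ring
      rw [e2, ← Real.norm_eq_abs]
      refine norm_integral_le_of_norm_le ((i1.const_mul _).add (integrable_const _)) ?_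
      filter_upwards [hσ] with z hz
      have hz' : ‖z‖ = ρ := mem_sphere_zero_iff_norm.1 hz
      have hzc := sphere_subset_closedBall hz
      have hyc : y ∈ closedBall (0 : EuclideanSpace ℝ (Fin N)) ρ := by simpa using hy.le
      have hP := PK_nonneg hy z
      rw [← mul_sub, norm_mul, Real.norm_of_nonneg hP]
      by_cases hd : dist z y < δ
      · have := hδf z hzc y hyc hd
        rw [dist_eq_norm] at this
        have h2 : 0 ≤ (ρ ^ 2 - ‖y‖ ^ 2) * (2 * M / δ ^ N) := by positivity
        nlinarith
      · push Not at hd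
        have h1 : ‖f z - f y‖ ≤ 2 * M := (norm_sub_le _ _).trans (by linarith [hM z hzc, hM y hyc])
        have h2 : PK ρ y z ≤ (ρ ^ 2 - ‖y‖ ^ 2) / δ ^ N := by
          rw [PK_eq]
          rw [dist_comm, dist_eq_norm] at hd
          gcongr
        calc PK ρ y z * ‖f z - f y‖ ≤ (ρ ^ 2 - ‖y‖ ^ 2) / δ ^ N * (2 * M) :=
              mul_le_mul h2 h1 (norm_nonneg _) (by positivity)
          _ = (ρ ^ 2 - ‖y‖ ^ 2) * (2 * M / δ ^ N) := by ring
          _ ≤ _ := by have : 0 ≤ ε' * PK ρ y z := by positivity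
                      linarith
    obtain ⟨K, hK⟩ : ∃ K, K = 2 * M / δ ^ N * m := ⟨_, rfl⟩
    rw [← hK] at est
    have hlim : Tendsto (fun s : ℝ => (ρ ^ 2 - s ^ 2) * K) (𝓝[<] ρ) (𝓝 0) := by
      have : Continuous (fun s : ℝ => (ρ ^ 2 - s ^ 2) * K) := by fun_prop
      simpa using (this.tendsto ρ).mono_left nhdsWithin_le_nhds
    have hev : ∀ᶠ s in 𝓝[<] ρ, (ρ ^ 2 - s ^ 2) * K < ε / 2 ∧ s ∈ Ioo ‖x‖ ρ :=
      (hlim.eventually (gt_mem_nhds (by positivity))).and (Ioo_mem_nhdsLT hx)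
    obtain ⟨s, hs1, hs2⟩ := hev.exists
    have hb : ∀ y, ‖y‖ = s → |W y| ≤ ε := by
      intro y hy
      have := est y (by rw [hy]; exact hs2.2)
      rw [hy] at this
      linarith
    have hxs : x ∈ closedBall (0 : EuclideanSpace ℝ (Fin N)) s := by simpa using hs2.1.le
    have hball : ∀ y ∈ ball (0 : EuclideanSpace ℝ (Fin N)) s, ‖y‖ < ρ := fun y hy =>
      (mem_ball_zero_iff.1 hy).trans hs2.2
    rw [abs_le]
    constructor
    · have := maxPrinciple hN (w := fun y => -1 * W y) (M := ε) (continuousOn_const.mul (hWc s hs2.2))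
        (fun y hy => by simpa using (hWh y (hball y hy)).smul (-1))
        (fun y hy => by linarith [(abs_le.1 (hb y hy)).1]) x hxs
      linarith
    · exact maxPrinciple hN (hWc s hs2.2) (fun y hy => hWh y (hball y hy))
        (fun y hy => (abs_le.1 (hb y hy)).2) x hxs
  have h0 : |W x| ≤ 0 := le_of_forall_pos_le_add fun ε hε => by simpa using key ε hε
  have h1 : W x = 0 := abs_eq_zero.1 (le_antisymm h0 (abs_nonneg _))
  simp only [hW] at h1
  linarith

theorem rp {n : ℕ} {a : ℝ} (ha : 0 < a) : a ^ (((n + 1 : ℕ) : ℝ) - 2) = a ^ n / a := by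
  have : (((n + 1 : ℕ) : ℝ) - 2) = (n : ℝ) - 1 := by push_cast; ring
  rw [this, Real.rpow_sub_one ha.ne', Real.rpow_natCast]

theorem PK_upper {N : ℕ} (hN : 1 ≤ N) {ρ r : ℝ} {x z : EuclideanSpace ℝ (Fin N)} (hx : ‖x‖ ≤ r)
    (hr : r < ρ) (hz : ‖z‖ = ρ) :
    PK ρ x z ≤ (ρ / (ρ - r)) ^ ((N : ℝ) - 2) * ((ρ + r) / (ρ - r)) * PK ρ 0 z := by
  obtain ⟨n, rfl⟩ : ∃ n, N = n + 1 := ⟨N - 1, by omega⟩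
  have hx0 := norm_nonneg x
  have hρ : 0 < ρ := by linarith
  have hρr : 0 < ρ - r := by linarith
  have hρx : 0 < ρ - ‖x‖ := by linarith
  rw [rp (by positivity), PK_eq, PK_eq]
  simp only [norm_zero, zero_sub, norm_neg, hz]
  have h1 : ρ - ‖x‖ ≤ ‖x - z‖ := by
    have := norm_sub_norm_le z x
    rw [norm_sub_rev] at this; linarith
  calc (ρ ^ 2 - ‖x‖ ^ 2) / ‖x - z‖ ^ (n + 1) ≤ (ρ ^ 2 - ‖x‖ ^ 2) / (ρ - ‖x‖) ^ (n + 1) := by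
        have : 0 ≤ ρ ^ 2 - ‖x‖ ^ 2 := by nlinarith
        gcongr
    _ = (ρ + ‖x‖) / (ρ - ‖x‖) ^ n := by field_simp; ring
    _ ≤ (ρ + r) / (ρ - r) ^ n := by gcongr; linarith
    _ = _ := by rw [div_pow]; field_simp; ring

theorem PK_lower {N : ℕ} (hN : 1 ≤ N) {ρ r : ℝ} {x z : EuclideanSpace ℝ (Fin N)} (hx : ‖x‖ ≤ r)
    (hr : r < ρ) (hz : ‖z‖ = ρ) :
    (ρ / (ρ + r)) ^ ((N : ℝ) - 2) * ((ρ - r) / (ρ + r)) * PK ρ 0 z ≤ PK ρ x z := by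
  obtain ⟨n, rfl⟩ : ∃ n, N = n + 1 := ⟨N - 1, by omega⟩
  have hx0 := norm_nonneg x
  have hr0 : 0 ≤ r := by linarith
  have hρ : 0 < ρ := by linarith
  have hρr : 0 < ρ - r := by linarith
  have hρx : 0 < ρ - ‖x‖ := by linarith
  have hp := sphere_ne (hx.trans_lt hr) hz
  rw [rp (by positivity), PK_eq, PK_eq]
  simp only [norm_zero, zero_sub, norm_neg, hz]
  have h1 : ‖x - z‖ ≤ ρ + ‖x‖ := by
    have := norm_sub_le x z
    linarith
  refine ge_iff_le.1 ?_
  calc (ρ ^ 2 - ‖x‖ ^ 2) / ‖x - z‖ ^ (n + 1) ≥ (ρ ^ 2 - ‖x‖ ^ 2) / (ρ + ‖x‖) ^ (n + 1) := by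
        have : 0 ≤ ρ ^ 2 - ‖x‖ ^ 2 := by nlinarith
        gcongr
    _ = (ρ - ‖x‖) / (ρ + ‖x‖) ^ n := by field_simp; ring
    _ ≥ (ρ - r) / (ρ + r) ^ n := by gcongr
    _ = _ := by rw [div_pow]; field_simp; ring

theorem harnack_rho {N : ℕ} (hN : 1 ≤ N) {ρ r : ℝ} {f : EuclideanSpace ℝ (Fin N) → ℝ}
    (hf : ContinuousOn f (closedBall 0 ρ)) (hh : ∀ x ∈ ball 0 ρ, HSD f x 0)
    (h0 : ∀ x ∈ closedBall 0 ρ, 0 ≤ f x)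
    {x : EuclideanSpace ℝ (Fin N)} (hx : ‖x‖ ≤ r) (hr : r < ρ) :
    (ρ / (ρ + r)) ^ ((N : ℝ) - 2) * ((ρ - r) / (ρ + r)) * f 0 ≤ f x ∧
      f x ≤ (ρ / (ρ - r)) ^ ((N : ℝ) - 2) * ((ρ + r) / (ρ - r)) * f 0 := by
  have hρ : 0 < ρ := by linarith [norm_nonneg x]
  obtain ⟨σ, hfin, hσ, hne, hL⟩ := exists_sigma hN hρ
  have hfs : ContinuousOn f (sphere 0 ρ) := hf.mono sphere_subset_closedBall
  have hz0 : ‖(0 : EuclideanSpace ℝ (Fin N))‖ < ρ := by simpa using hρ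
  have px := poisson hN hρ hσ hL hf hh (hx.trans_lt hr)
  have p0 := poisson hN hρ hσ hL hf hh hz0
  have ix : Integrable (fun z => PK ρ x z * f z) σ := sint hσ ((PK_slice (hx.trans_lt hr)).mul hfs)
  have i0 : Integrable (fun z => PK ρ 0 z * f z) σ := sint hσ ((PK_slice hz0).mul hfs)
  have hc : 0 < ∫ z, PK ρ 0 z ∂σ := by
    have : ∫ z, PK ρ 0 z ∂σ = ∫ z, ρ ^ 2 / ρ ^ N ∂σ := by
      refine integral_congr_ae ?_
      filter_upwards [hσ] with z hz
      rw [PK_eq, zero_sub, norm_neg, mem_sphere_zero_iff_norm.1 hz]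
      simp
    rw [this, integral_const, smul_eq_mul]
    have : 0 < σ.real univ := by
      rw [measureReal_def, ENNReal.toReal_pos_iff]
      exact ⟨pos_iff_ne_zero.2 (by simpa using hne), measure_lt_top _ _⟩
    positivity
  constructor
  · set C := (ρ / (ρ + r)) ^ ((N : ℝ) - 2) * ((ρ - r) / (ρ + r))
    have : C * ∫ z, PK ρ 0 z * f z ∂σ ≤ ∫ z, PK ρ x z * f z ∂σ := by
      rw [← integral_const_mul]
      refine integral_mono_ae (i0.const_mul _) ix ?_
      filter_upwards [hσ] with z hz
      rw [← mul_assoc]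
      exact mul_le_mul_of_nonneg_right (PK_lower hN hx hr (mem_sphere_zero_iff_norm.1 hz))
        (h0 z (sphere_subset_closedBall hz))
    rw [px, p0] at this
    refine le_of_mul_le_mul_left ?_ hc
    linarith
  · set C := (ρ / (ρ - r)) ^ ((N : ℝ) - 2) * ((ρ + r) / (ρ - r))
    have : ∫ z, PK ρ x z * f z ∂σ ≤ C * ∫ z, PK ρ 0 z * f z ∂σ := by
      rw [← integral_const_mul]
      refine integral_mono_ae ix (i0.const_mul _) ?_
      filter_upwards [hσ] with z hz
      rw [← mul_assoc]
      exact mul_le_mul_of_nonneg_right (PK_upper hN hx hr (mem_sphere_zero_iff_norm.1 hz))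
        (h0 z (sphere_subset_closedBall hz))
    rw [px, p0] at this
    refine le_of_mul_le_mul_left ?_ hc
    linarith

theorem HSD_of_harmonic {N : ℕ} {x₀ : EuclideanSpace ℝ (Fin N)} {R : ℝ}
    {u : EuclideanSpace ℝ (Fin N) → ℝ} (hu : HarmonicOn u (ball x₀ R))
    {y : EuclideanSpace ℝ (Fin N)} (hy : ‖y‖ < R) : HSD (fun y => u (x₀ + y)) y 0 := by
  have hmem : x₀ + y ∈ ball x₀ R := by simpa [dist_eq_norm] using hy
  have hcd : ContDiffAt ℝ 2 u (x₀ + y) := hu.1.contDiffAt (isOpen_ball.mem_nhds hmem)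
  refine ⟨fun i t => fderiv ℝ u (x₀ + y + t • EuclideanSpace.single i 1) (EuclideanSpace.single i 1),
    fun i => fderiv ℝ (fun y => fderiv ℝ u y (EuclideanSpace.single i 1)) (x₀ + y) (EuclideanSpace.single i 1),
    fun i => ?_, hu.2 _ hmem⟩
  have hl : ∀ t : ℝ, HasDerivAt (fun t : ℝ => x₀ + y + t • EuclideanSpace.single i (1:ℝ))
      (EuclideanSpace.single i 1) t := fun t => by
    simpa using ((hasDerivAt_id t).smul_const (EuclideanSpace.single i (1:ℝ))).const_add (x₀ + y)
  constructor
  · have : ∀ᶠ t in 𝓝 (0:ℝ), x₀ + y + t • EuclideanSpace.single i (1:ℝ) ∈ ball x₀ R := by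
      refine (hl 0).continuousAt.eventually_mem ?_
      simpa using isOpen_ball.mem_nhds hmem
    filter_upwards [this] with t ht
    have hd : DifferentiableAt ℝ u (x₀ + y + t • EuclideanSpace.single i (1:ℝ)) :=
      (hu.1.contDiffAt (isOpen_ball.mem_nhds ht)).differentiableAt (by norm_num)
    simpa only [add_assoc, Function.comp_def] using hd.hasFDerivAt.comp_hasDerivAt t (hl t)
  · have h1 : DifferentiableAt ℝ (fderiv ℝ u) (x₀ + y) :=
      (hcd.fderiv_right (m := 1) (by norm_num)).differentiableAt (by norm_num)
    have h2 : DifferentiableAt ℝ (fun y => fderiv ℝ u y (EuclideanSpace.single i 1)) (x₀ + y) :=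
      h1.clm_apply (differentiableAt_const _)
    have h3 := h2.hasFDerivAt
    have e : x₀ + y = x₀ + y + (0:ℝ) • EuclideanSpace.single i (1:ℝ) := by simp
    have h4 : HasFDerivAt (fun y => fderiv ℝ u y (EuclideanSpace.single i 1))
      (fderiv ℝ (fun y => fderiv ℝ u y (EuclideanSpace.single i 1)) (x₀ + y))
      (x₀ + y + (0:ℝ) • EuclideanSpace.single i (1:ℝ)) := by rw [← e]; exact h3
    exact h4.comp_hasDerivAt 0 (hl 0)

/-- Harnack's inequality in a ball, any dimension `N ≥ 1`. -/
theorem harnack_original (N : ℕ) (hN : 1 ≤ N)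
    (x₀ : EuclideanSpace ℝ (Fin N)) (R : ℝ)
    (u : EuclideanSpace ℝ (Fin N) → ℝ)
    (hu : HarmonicOn u (ball x₀ R))
    (hnonneg : ∀ x ∈ ball x₀ R, 0 ≤ u x) :
    ∀ r : ℝ, 0 ≤ r → r < R →
      ∀ x : EuclideanSpace ℝ (Fin N), ‖x - x₀‖ ≤ r →
        (R / (R + r)) ^ ((N : ℝ) - 2) * ((R - r) / (R + r)) * u x₀ ≤ u x ∧
          u x ≤ (R / (R - r)) ^ ((N : ℝ) - 2) * ((R + r) / (R - r)) * u x₀ := by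
  intro r hr0 hrR x hx
  have hR : 0 < R := by linarith
  set f : EuclideanSpace ℝ (Fin N) → ℝ := fun y => u (x₀ + y) with hf
  have key : ∀ ρ ∈ Ioo r R, (ρ / (ρ + r)) ^ ((N : ℝ) - 2) * ((ρ - r) / (ρ + r)) * u x₀ ≤ u x ∧
      u x ≤ (ρ / (ρ - r)) ^ ((N : ℝ) - 2) * ((ρ + r) / (ρ - r)) * u x₀ := by
    intro ρ hρ
    have hsub : ∀ y ∈ closedBall (0 : EuclideanSpace ℝ (Fin N)) ρ, x₀ + y ∈ ball x₀ R := by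
      intro y hy
      have : ‖y‖ ≤ ρ := by simpa using hy
      simpa [dist_eq_norm] using this.trans_lt hρ.2
    have h := harnack_rho hN (ρ := ρ) (r := r) (f := f)
      (hu.1.continuousOn.comp (by fun_prop) hsub)
      (fun y hy => HSD_of_harmonic hu ((mem_ball_zero_iff.1 hy).trans hρ.2))
      (fun y hy => hnonneg _ (hsub y hy)) hx hρ.1
    simpa [hf] using h
  have hev : ∀ᶠ ρ in 𝓝[<] R, ρ ∈ Ioo r R := Ioo_mem_nhdsLT hrR
  have hRr : R - r ≠ 0 := by linarith
  have hRr' : R + r ≠ 0 := by linarith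
  constructor
  · have hc : ContinuousAt (fun ρ : ℝ => (ρ / (ρ + r)) ^ ((N : ℝ) - 2) * ((ρ - r) / (ρ + r)) * u x₀) R := by
      refine ContinuousAt.mul (ContinuousAt.mul (ContinuousAt.rpow_const ?_ (Or.inl ?_)) ?_) continuousAt_const
      · exact continuousAt_id.div (by fun_prop) hRr'
      · exact div_ne_zero hR.ne' hRr'
      · exact ContinuousAt.div (by fun_prop) (by fun_prop) hRr'
    exact le_of_tendsto (hc.tendsto.mono_left (nhdsWithin_le_nhds (s := Iio R))) (hev.mono fun ρ h => (key ρ h).1)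
  · have hc : ContinuousAt (fun ρ : ℝ => (ρ / (ρ - r)) ^ ((N : ℝ) - 2) * ((ρ + r) / (ρ - r)) * u x₀) R := by
      refine ContinuousAt.mul (ContinuousAt.mul (ContinuousAt.rpow_const ?_ (Or.inl ?_)) ?_) continuousAt_const
      · exact continuousAt_id.div (by fun_prop) hRr
      · exact div_ne_zero hR.ne' hRr
      · exact ContinuousAt.div (by fun_prop) (by fun_prop) hRr
    exact ge_of_tendsto (hc.tendsto.mono_left (nhdsWithin_le_nhds (s := Iio R))) (hev.mono fun ρ h => (key ρ h).2)
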